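/- arXiv:2403.20010 — 2 statements merged into one kernel-verified Lean document; each statement's English description precedes it below -/
import Mathlib

section
/- Let ξ⁰ ∈ Γ₅ be the configuration on ℤ/5ℤ with ξ⁰_1 = ξ⁰_2 = 1, ξ⁰_3 = −1, ξ⁰_4 = 0, ξ⁰_5 = −1. Then every configuration ξ' that is reachable from ξ⁰ by a finite sequence of SWT jumps and satisfies ξ'_4 = 1 also satisfies ξ'_3 ≥ 0 or ξ'_5 ≥ 0 (i.e. at least one of the two traps has been filled). -/
/-- The SWT configuration after the particle at site `k` jumps to site `k + z`. -/
def swtJumpConfig {K : ℕ} (ξ : ZMod K → ℤ) (k z : ZMod K) : ZMod K → ℤ :=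
  fun k' => if k' = k then 0 else if k' = k + z then ξ (k + z) + 1 else ξ k'

/-- One jump of the SSEP with traps: a particle (`ξ k = 1`) jumps to a neighbouring
non-particle site (`ξ (k + z) ≤ 0`, `z = ±1`), filling it up by one. -/
def SWTJump {K : ℕ} (ξ ξ' : ZMod K → ℤ) : Prop :=
  ∃ k z : ZMod K, (z = 1 ∨ z = -1) ∧ ξ k = 1 ∧ ξ (k + z) ≤ 0 ∧ ξ' = swtJumpConfig ξ k z

theorem SWTJump.nonneg {K : ℕ} {ξ ξ' : ZMod K → ℤ} (h : SWTJump ξ ξ') {x : ZMod K}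
    (hx : 0 ≤ ξ x) : 0 ≤ ξ' x := by
  obtain ⟨k, z, -, -, -, rfl⟩ := h
  unfold swtJumpConfig
  split_ifs with h₁ h₂
  · exact le_rfl
  · rw [← h₂]
    omega
  · exact hx

/-- A particle can appear at a site only by jumping from a neighbouring site. -/
theorem SWTJump.neighbor_eq_one {K : ℕ} {ξ ξ' : ZMod K → ℤ} (h : SWTJump ξ ξ') {x : ZMod K}
    (hx : ξ x ≤ 0) (hx' : 0 < ξ' x) : ξ (x - 1) = 1 ∨ ξ (x + 1) = 1 := by
  obtain ⟨k, z, hz, hk, -, rfl⟩ := h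
  unfold swtJumpConfig at hx'
  split_ifs at hx' with h₁ h₂
  · omega
  · subst h₂
    rcases hz with rfl | rfl
    · left
      simpa using hk
    · right
      simpa using hk
  · omega

/-- Let `ξ⁰ ∈ Γ₅` be the configuration on `ℤ/5ℤ` with
`ξ⁰ = (1, 1, -1, 0, -1)` at sites `1, 2, 3, 4, 5`.  Every configuration `ξ'` reachable
from `ξ⁰` by finitely many SWT jumps and having a particle at site `4` satisfies
`ξ' 3 ≥ 0` or `ξ' 5 ≥ 0`: at least one of the two traps has been filled. -/
theorem swt_trap_counterexample_five :
    ∀ ξ' : ZMod 5 → ℤ,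
      Relation.ReflTransGen SWTJump
        (fun k : ZMod 5 => if k = 1 then 1 else if k = 2 then 1 else
          if k = 3 then -1 else if k = 4 then 0 else -1) ξ' →
      ξ' 4 = 1 → (0 ≤ ξ' 3 ∨ 0 ≤ ξ' 5) := by
  intro ξ' hreach h4
  have key : 0 ≤ ξ' 3 ∨ 0 ≤ ξ' 5 ∨ ξ' 4 ≤ 0 := by
    clear h4
    induction hreach with
    | refl => exact Or.inr (Or.inr (by decide))
    | @tail η η' _ hjump ih =>
      rcases ih with h | h | h
      · exact Or.inl (hjump.nonneg h)
      · exact Or.inr (Or.inl (hjump.nonneg h))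
      · by_cases h' : 0 < η' 4
        · have hn := hjump.neighbor_eq_one h h'
          rw [show (4 : ZMod 5) - 1 = 3 by decide, show (4 : ZMod 5) + 1 = 5 by decide] at hn
          rcases hn with hn | hn
          · exact Or.inl (hjump.nonneg (by omega))
          · exact Or.inr (Or.inl (hjump.nonneg (by omega)))
        · exact Or.inr (Or.inr (not_lt.mp h'))
  omega
end

section
/- Let ξ⁰ ∈ Γ₇ be the configuration on ℤ/7ℤ with (ξ⁰_1,…,ξ⁰_7) = (−3, 1, 1, 1, 0, −1, 0). Then: (a) the minimal n such that some configuration ξ' with ξ'_6 = 1 is reachable from ξ⁰ in n SWT jumps equals 5; (b) the minimal n such that some ξ' with ξ'_7 = 1 is reachable from ξ⁰ in n SWT jumps equals 6; (c) the minimal n such that some ξ' with ξ'_6 = 1 and ξ'_7 = 1 is reachable from ξ⁰ in n SWT jumps equals 10. -/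
/-- `SWTReachIn n ξ ξ'` : the configuration `ξ'` is reachable from `ξ` in exactly `n`
SWT jumps. -/
def SWTReachIn {K : ℕ} : ℕ → (ZMod K → ℤ) → (ZMod K → ℤ) → Prop
  | 0 => fun ξ ξ' => ξ' = ξ
  | n + 1 => fun ξ ξ' => ∃ ξ'', SWTReachIn n ξ ξ'' ∧ SWTJump ξ'' ξ'

/-- The configuration `(-3, 1, 1, 1, 0, -1, 0)` on `ℤ/7ℤ` (sites `1, …, 7`, with `7 = 0`). -/
def swtXi0 : ZMod 7 → ℤ :=
  fun k => if k = 1 then -3 else if k = 2 then 1 else if k = 3 then 1 else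
    if k = 4 then 1 else if k = 5 then 0 else if k = 6 then -1 else 0

/-- Appending an admissible jump to a chain of jumps. -/
lemma SWTReachIn.step {K n : ℕ} {ξ η : ZMod K → ℤ} (h : SWTReachIn n ξ η) (k z : ZMod K)
    (hz : z = 1 ∨ z = -1) (hk : η k = 1) (hkz : η (k + z) ≤ 0) :
    SWTReachIn (n + 1) ξ (swtJumpConfig η k z) :=
  ⟨η, h, k, z, hz, hk, hkz, rfl⟩

/-- Properties of every configuration `ξ` reachable from `swtXi0` in `n` jumps. The total charge
is conserved, so the trap at site `1` is never filled; hence no particle jumps out of site `1`, and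
site `7` is only entered from site `6`. Each jump raises the weighted sum by at most one. -/
structure SWTInvariant (n : ℕ) (ξ : ZMod 7 → ℤ) : Prop where
  charge : ξ 1 + ξ 2 + ξ 3 + ξ 4 + ξ 5 + ξ 6 + ξ 0 = -1
  one_ge : -3 ≤ ξ 1
  two_nonneg : 0 ≤ ξ 2
  two_le : ξ 2 ≤ 1
  three_nonneg : 0 ≤ ξ 3
  four_nonneg : 0 ≤ ξ 4
  five_nonneg : 0 ≤ ξ 5
  six_ge : -1 ≤ ξ 6
  zero_nonneg : 0 ≤ ξ 0
  six_of_zero : 0 < ξ 0 → 0 ≤ ξ 6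
  weight_le : 3 * ξ 1 + 2 * ξ 2 + 3 * ξ 3 + 4 * ξ 4 + 5 * ξ 5 + 6 * ξ 6 + 7 * ξ 0 ≤ n - 6

lemma swtInvariant_zero : SWTInvariant 0 swtXi0 := by
  constructor <;> decide

lemma SWTInvariant.jump {n : ℕ} {ξ ξ' : ZMod 7 → ℤ} (h : SWTInvariant n ξ) (hj : SWTJump ξ ξ') :
    SWTInvariant (n + 1) ξ' := by
  obtain ⟨k, z, hz, hk, hkz, rfl⟩ := hj
  obtain ⟨h1, h2, h3, h4, h5, h6, h7, h8, h9, h10, h11⟩ := h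
  have key : ∀ i, swtJumpConfig ξ k z i =
      if i = k then 0 else if i = k + z then ξ (k + z) + 1 else ξ i := fun _ => rfl
  have e0 := key 0
  have e1 := key 1
  have e2 := key 2
  have e3 := key 3
  have e4 := key 4
  have e5 := key 5
  have e6 := key 6
  generalize swtJumpConfig ξ k z = η at *
  clear key
  have hcases : ∀ k : ZMod 7, k = 0 ∨ k = 1 ∨ k = 2 ∨ k = 3 ∨ k = 4 ∨ k = 5 ∨ k = 6 := by decide
  have s0 : (0 : ZMod 7) + -1 = 6 := by decide
  have s1 : (1 : ZMod 7) + -1 = 0 := by decide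
  have s2 : (2 : ZMod 7) + -1 = 1 := by decide
  have s3 : (3 : ZMod 7) + -1 = 2 := by decide
  have s4 : (4 : ZMod 7) + -1 = 3 := by decide
  have s5 : (5 : ZMod 7) + -1 = 4 := by decide
  have s6 : (6 : ZMod 7) + -1 = 5 := by decide
  have t0 : (0 : ZMod 7) + 1 = 1 := by decide
  have t1 : (1 : ZMod 7) + 1 = 2 := by decide
  have t2 : (2 : ZMod 7) + 1 = 3 := by decide
  have t3 : (3 : ZMod 7) + 1 = 4 := by decide
  have t4 : (4 : ZMod 7) + 1 = 5 := by decide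
  have t5 : (5 : ZMod 7) + 1 = 6 := by decide
  have t6 : (6 : ZMod 7) + 1 = 0 := by decide
  rcases hcases k with rfl | rfl | rfl | rfl | rfl | rfl | rfl <;> rcases hz with rfl | rfl <;>
    simp only [s0, s1, s2, s3, s4, s5, s6, t0, t1, t2, t3, t4, t5, t6] at hkz e0 e1 e2 e3 e4 e5 e6 <;>
    simp +decide only [if_true, if_false] at e0 e1 e2 e3 e4 e5 e6 <;>
    constructor <;> push_cast <;> omega

lemma SWTReachIn.swtInvariant {n : ℕ} {ξ : ZMod 7 → ℤ} (h : SWTReachIn n swtXi0 ξ) :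
    SWTInvariant n ξ := by
  induction n generalizing ξ with
  | zero => obtain rfl : ξ = swtXi0 := h; exact swtInvariant_zero
  | succ n ih => obtain ⟨η, hη, hj⟩ := h; exact (ih hη).jump hj

/-- Starting from `ξ⁰ = (-3, 1, 1, 1, 0, -1, 0)` on `ℤ/7ℤ`:
(a) the least number of SWT jumps needed to put a (live) particle at site `6` is `5`;
(b) the least number of jumps needed to put a particle at site `7` is `6`;
(c) the least number of jumps needed to have particles at both sites `6` and `7` is `10`. -/
theorem swt_minimal_jump_counts :
    IsLeast {n : ℕ | ∃ ξ' : ZMod 7 → ℤ, SWTReachIn n swtXi0 ξ' ∧ ξ' 6 = 1} 5 ∧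
    IsLeast {n : ℕ | ∃ ξ' : ZMod 7 → ℤ, SWTReachIn n swtXi0 ξ' ∧ ξ' 7 = 1} 6 ∧
    IsLeast {n : ℕ | ∃ ξ' : ZMod 7 → ℤ,
      SWTReachIn n swtXi0 ξ' ∧ ξ' 6 = 1 ∧ ξ' 7 = 1} 10 := by
  have r5 := (((((show SWTReachIn 0 swtXi0 swtXi0 from rfl).step
    4 1 (by decide) (by decide) (by decide)).step
    5 1 (by decide) (by decide) (by decide)).step
    3 1 (by decide) (by decide) (by decide)).step
    4 1 (by decide) (by decide) (by decide)).step
    5 1 (by decide) (by decide) (by decide)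
  have r6 := r5.step 6 1 (by decide) (by decide) (by decide)
  have r10 := (((r6.step
    2 1 (by decide) (by decide) (by decide)).step
    3 1 (by decide) (by decide) (by decide)).step
    4 1 (by decide) (by decide) (by decide)).step
    5 1 (by decide) (by decide) (by decide)
  have seven : (7 : ZMod 7) = 0 := by decide
  refine ⟨⟨⟨_, r5, by decide⟩, ?_⟩, ⟨⟨_, r6, by decide⟩, ?_⟩,
    ⟨⟨_, r10, by decide, by decide⟩, ?_⟩⟩
  · rintro n ⟨ξ, hr, h6⟩
    obtain ⟨h1, h2, h3, h4, h5, h6', h7, h8, h9, h10, h11⟩ := hr.swtInvariant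
    omega
  · rintro n ⟨ξ, hr, h0⟩
    rw [seven] at h0
    obtain ⟨h1, h2, h3, h4, h5, h6', h7, h8, h9, h10, h11⟩ := hr.swtInvariant
    omega
  · rintro n ⟨ξ, hr, h6, h0⟩
    rw [seven] at h0
    obtain ⟨h1, h2, h3, h4, h5, h6', h7, h8, h9, h10, h11⟩ := hr.swtInvariant
    omega
end
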